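/- Let G be a (P5,dart)-free finite simple graph containing an induced 5-cycle C with vertices v1,...,v5, and let the sets S2(i) be defined with respect to C as in the context. Then for each 1 ≤ i ≤ 5, every connected component A of the induced subgraph G[S2(i)] is a homogeneous set of G and is P3-free (hence A is a clique). -/

import Mathlib

open SimpleGraph

/-- `G` contains an induced subgraph isomorphic to `H`. -/
def ContainsInduced {V : Type*} {W : Type*} (G : SimpleGraph V) (H : SimpleGraph W) : Prop :=
  ∃ f : W ↪ V, ∀ a b, H.Adj a b ↔ G.Adj (f a) (f b)

/-- The path on 5 vertices. -/
def P5 : SimpleGraph (Fin 5) := SimpleGraph.pathGraph 5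

/-- The dart: vertices `0,1,2,3,4` and edges `01, 12, 23, 30, 02, 24`. -/
def dart : SimpleGraph (Fin 5) :=
  SimpleGraph.fromRel (fun a b =>
    (a, b) = (0, 1) ∨ (a, b) = (1, 2) ∨ (a, b) = (2, 3) ∨
    (a, b) = (3, 0) ∨ (a, b) = (0, 2) ∨ (a, b) = (2, 4))

/-- `G` is `k`-vertex-critical: `χ(G) = k` and `χ(G - v) < k` for every vertex `v`. -/
def IsVertexCritical {V : Type*} (G : SimpleGraph V) (k : ℕ) : Prop :=
  G.chromaticNumber = k ∧
  ∀ v : V, (G.induce {u | u ≠ v}).chromaticNumber < k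

/-- `S` is a homogeneous set of `G`: every vertex outside `S` is adjacent either to
all vertices of `S` or to none of them. -/
def IsHomogeneous {V : Type*} (G : SimpleGraph V) (S : Set V) : Prop :=
  ∀ u ∉ S, (∀ s ∈ S, G.Adj u s) ∨ (∀ s ∈ S, ¬ G.Adj u s)

/-- The cycle on 5 vertices (indices in `Fin 5`, `i` adjacent to `i + 1`). -/
def C5 : SimpleGraph (Fin 5) := SimpleGraph.fromRel (fun a b => b = a + 1)

/-- `S0`: the vertices off the 5-cycle `v` with no neighbour on it. -/
def S0 {V : Type*} (G : SimpleGraph V) (v : Fin 5 → V) : Set V :=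
  {u | u ∉ Set.range v ∧ ∀ j, ¬ G.Adj u (v j)}

/-- `S2(i)`: vertices off the 5-cycle `v` whose neighbourhood on it is exactly
`{v (i-1), v (i+1)}`. -/
def S2 {V : Type*} (G : SimpleGraph V) (v : Fin 5 → V) (i : Fin 5) : Set V :=
  {u | u ∉ Set.range v ∧ ∀ j, G.Adj u (v j) ↔ (j = i - 1 ∨ j = i + 1)}

/-- `S3^1(i)`: vertices off the 5-cycle `v` whose neighbourhood on it is exactly
`{v (i-1), v i, v (i+1)}`. -/
def S31 {V : Type*} (G : SimpleGraph V) (v : Fin 5 → V) (i : Fin 5) : Set V :=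
  {u | u ∉ Set.range v ∧ ∀ j, G.Adj u (v j) ↔ (j = i - 1 ∨ j = i ∨ j = i + 1)}

/-- `S3^2(i)`: vertices off the 5-cycle `v` whose neighbourhood on it is exactly
`{v (i-2), v i, v (i+2)}`. -/
def S32 {V : Type*} (G : SimpleGraph V) (v : Fin 5 → V) (i : Fin 5) : Set V :=
  {u | u ∉ Set.range v ∧ ∀ j, G.Adj u (v j) ↔ (j = i - 2 ∨ j = i ∨ j = i + 2)}

/-- `S4(i)`: vertices off the 5-cycle `v` whose neighbourhood on it is exactly
`{v (i-2), v (i-1), v (i+1), v (i+2)}`. -/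
def S4 {V : Type*} (G : SimpleGraph V) (v : Fin 5 → V) (i : Fin 5) : Set V :=
  {u | u ∉ Set.range v ∧
    ∀ j, G.Adj u (v j) ↔ (j = i - 2 ∨ j = i - 1 ∨ j = i + 1 ∨ j = i + 2)}

/-- `S5`: vertices off the 5-cycle `v` adjacent to all five of its vertices. -/
def S5 {V : Type*} (G : SimpleGraph V) (v : Fin 5 → V) : Set V :=
  {u | u ∉ Set.range v ∧ ∀ j, G.Adj u (v j)}

section DartFree

variable {V : Type*} {G : SimpleGraph V}

theorem containsInduced_dart {a b c d e : V} (hab : G.Adj a b) (hbc : G.Adj b c)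
    (hcd : G.Adj c d) (hda : G.Adj d a) (hac : G.Adj a c) (hce : G.Adj c e) (hne : b ≠ d)
    (hbd : ¬ G.Adj b d) (hea : ¬ G.Adj e a) (heb : ¬ G.Adj e b) (hed : ¬ G.Adj e d) :
    ContainsInduced G dart := by
  have hea' : e ≠ a := by rintro rfl; exact heb hab
  have heb' : e ≠ b := by rintro rfl; exact hea hab.symm
  have hed' : e ≠ d := by rintro rfl; exact hea hda
  refine ⟨⟨![a, b, c, d, e], ?_⟩, ?_⟩
  · intro x y hxy
    have := hab.ne
    have := hbc.ne
    have := hcd.ne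
    have := hda.ne
    have := hac.ne
    have := hce.ne
    fin_cases x <;> fin_cases y <;> simp_all
  · intro x y
    change dart.Adj x y ↔ G.Adj (![a, b, c, d, e] x) (![a, b, c, d, e] y)
    fin_cases x <;> fin_cases y <;>
      simp [dart, hab, hbc, hcd, hda, hac, hce, hab.symm, hbc.symm, hcd.symm, hda.symm, hac.symm,
        hce.symm, hbd, hea, heb, hed, G.adj_comm d b, G.adj_comm a e, G.adj_comm b e,
        G.adj_comm d e]

/-- The middle vertex of an induced path of length two and a common neighbour `p` of the path
are the hubs of a dart as soon as `p` has a private neighbour `q`. -/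
theorem adj_trans_of_dart_free (hdart : ¬ ContainsInduced G dart) {x y z p q : V}
    (hxy : G.Adj x y) (hyz : G.Adj y z) (hxz : x ≠ z)
    (hpx : G.Adj p x) (hpy : G.Adj p y) (hpz : G.Adj p z) (hpq : G.Adj p q)
    (hqx : ¬ G.Adj q x) (hqy : ¬ G.Adj q y) (hqz : ¬ G.Adj q z) : G.Adj x z := by
  by_contra h
  exact hdart (containsInduced_dart hxy.symm hpx.symm hpz hyz.symm hpy.symm hpq hxz h hqy hqx hqz)

/-- In a dart-free graph, a vertex distinguishing two adjacent vertices `s`, `t` is nonadjacent to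
every common neighbour `p` of `s` and `t` that has two nonadjacent neighbours `q`, `r`
outside the neighbourhoods of `s` and `t`. -/
theorem not_adj_common_neighbor_of_dart_free (hdart : ¬ ContainsInduced G dart)
    {s t u p q r : V} (hst : G.Adj s t) (hus : G.Adj u s) (hut : ¬ G.Adj u t) (hne : u ≠ t)
    (hps : G.Adj p s) (hpt : G.Adj p t) (hpq : G.Adj p q) (hpr : G.Adj p r) (hqr : q ≠ r)
    (hnqr : ¬ G.Adj q r) (hqs : ¬ G.Adj q s) (hqt : ¬ G.Adj q t)
    (hrs : ¬ G.Adj r s) (hrt : ¬ G.Adj r t) : ¬ G.Adj u p := by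
  intro hup
  have huq : G.Adj q u := by
    by_contra h
    exact hut (adj_trans_of_dart_free hdart hus hst hne hup.symm hps hpt hpq h hqs hqt)
  have hur : G.Adj r u := by
    by_contra h
    exact hut (adj_trans_of_dart_free hdart hus hst hne hup.symm hps hpt hpr h hrs hrt)
  exact hdart (containsInduced_dart huq.symm hpq.symm hpr hur hup hpt hqr hnqr
    (fun h => hut h.symm) (fun h => hqt h.symm) (fun h => hrt h.symm))

variable {v : Fin 5 → V}

theorem S2_adj_trans (hdart : ¬ ContainsInduced G dart)
    (hC : ∀ i j, G.Adj (v i) (v j) ↔ C5.Adj i j) {i : Fin 5} {x y z : V}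
    (hx : x ∈ S2 G v i) (hy : y ∈ S2 G v i) (hz : z ∈ S2 G v i)
    (hxy : G.Adj x y) (hyz : G.Adj y z) (hxz : x ≠ z) : G.Adj x z := by
  have near : ∀ w ∈ S2 G v i, G.Adj (v (i + 1)) w := fun w hw =>
    ((hw.2 _).2 (Or.inr rfl)).symm
  have far : ∀ w ∈ S2 G v i, ¬ G.Adj (v (i + 2)) w := fun w hw h => by
    have := (hw.2 _).1 h.symm
    revert this; clear * -; revert i; decide
  refine adj_trans_of_dart_free hdart hxy hyz hxz (near x hx) (near y hy) (near z hz)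
    (q := v (i + 2)) ?_ (far x hx) (far y hy) (far z hz)
  rw [hC]
  clear * -
  simp only [C5, SimpleGraph.fromRel_adj]
  revert i; decide

theorem S2_adj_of_adj (hdart : ¬ ContainsInduced G dart) (hinj : Function.Injective v)
    (hC : ∀ i j, G.Adj (v i) (v j) ↔ C5.Adj i j) {i : Fin 5} {s t u : V}
    (hs : s ∈ S2 G v i) (ht : t ∈ S2 G v i) (hst : G.Adj s t)
    (hus : G.Adj u s) (hne : u ≠ t) : G.Adj u t := by
  by_contra hut
  have near : ∀ w ∈ S2 G v i, ∀ j, j = i - 1 ∨ j = i + 1 → G.Adj (v j) w := fun w hw j hj =>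
    ((hw.2 j).2 hj).symm
  have far : ∀ w ∈ S2 G v i, ∀ j, ¬ (j = i - 1 ∨ j = i + 1) → ¬ G.Adj (v j) w :=
    fun w hw j hj h => hj ((hw.2 j).1 h.symm)
  have cyc : C5.Adj (i + 1) i ∧ C5.Adj (i + 1) (i + 2) ∧ ¬ C5.Adj i (i + 2) ∧
      C5.Adj (i - 1) i ∧ C5.Adj (i - 1) (i - 2) ∧ ¬ C5.Adj i (i - 2) ∧
      ¬ C5.Adj (i + 1) (i - 1) := by
    clear * -
    simp only [C5, SimpleGraph.fromRel_adj]
    revert i; decide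
  have idx : i ≠ i + 2 ∧ i ≠ i - 2 ∧ i + 1 ≠ i - 1 ∧ ¬ (i = i - 1 ∨ i = i + 1) ∧
      ¬ (i + 2 = i - 1 ∨ i + 2 = i + 1) ∧ ¬ (i - 2 = i - 1 ∨ i - 2 = i + 1) := by
    clear * -
    revert i; decide
  simp only [← hC] at cyc
  obtain ⟨c₁, c₂, c₃, c₄, c₅, c₆, c₇⟩ := cyc
  obtain ⟨n₁, n₂, n₃, f₁, f₂, f₃⟩ := idx
  have hright : ¬ G.Adj u (v (i + 1)) :=
    not_adj_common_neighbor_of_dart_free hdart hst hus hut hne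
      (near s hs _ (.inr rfl)) (near t ht _ (.inr rfl)) c₁ c₂ (hinj.ne n₁) c₃
      (far s hs _ f₁) (far t ht _ f₁) (far s hs _ f₂) (far t ht _ f₂)
  have hleft : ¬ G.Adj u (v (i - 1)) :=
    not_adj_common_neighbor_of_dart_free hdart hst hus hut hne
      (near s hs _ (.inl rfl)) (near t ht _ (.inl rfl)) c₄ c₅ (hinj.ne n₂) c₆
      (far s hs _ f₁) (far t ht _ f₁) (far s hs _ f₃) (far t ht _ f₃)
  exact hdart (containsInduced_dart (near t ht _ (.inr rfl)).symm (near s hs _ (.inr rfl))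
    (near s hs _ (.inl rfl)).symm (near t ht _ (.inl rfl)) hst.symm hus.symm (hinj.ne n₃) c₇
    hut hright hleft)

end DartFree

theorem S2_components_homogeneous_P3_free {V : Type} [Fintype V] (G : SimpleGraph V)
    (hP5 : ¬ ContainsInduced G P5) (hdart : ¬ ContainsInduced G dart)
    (v : Fin 5 → V) (hinj : Function.Injective v)
    (hC : ∀ i j, G.Adj (v i) (v j) ↔ C5.Adj i j) :
    ∀ i : Fin 5, ∀ c : (G.induce (S2 G v i)).ConnectedComponent,
      IsHomogeneous G (Subtype.val '' c.supp) ∧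
      ¬ ContainsInduced (G.induce (Subtype.val '' c.supp)) (SimpleGraph.pathGraph 3) := by
  intro i c
  have hS : ∀ x ∈ Subtype.val '' c.supp, x ∈ S2 G v i := by
    rintro _ ⟨x, -, rfl⟩
    exact x.2
  refine ⟨fun u hu => ?_, ?_⟩
  · by_contra! hcon
    obtain ⟨⟨_, ⟨t, ht, rfl⟩, hut⟩, _, ⟨s, hs, rfl⟩, hus⟩ := hcon
    obtain ⟨w⟩ := SimpleGraph.ConnectedComponent.exact
      ((show _ = c from hs).trans (show _ = c from ht).symm)
    have key : ∀ {a b : S2 G v i}, (G.induce (S2 G v i)).Walk a b → a ∈ c.supp →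
        G.Adj u a → G.Adj u b := by
      intro a b w
      induction w with
      | nil => exact fun _ h => h
      | @cons a b _ hab _ ih =>
        intro ha hua
        have hb : b ∈ c.supp := (c.mem_supp_congr_adj hab).1 ha
        refine ih hb (S2_adj_of_adj hdart hinj hC a.2 b.2 hab hua ?_)
        rintro rfl
        exact hu ⟨b, hb, rfl⟩
    exact hut (key w hs hus)
  · rintro ⟨f, hf⟩
    have h01 := (hf 0 1).1 (by simp [SimpleGraph.pathGraph_adj])
    have h12 := (hf 1 2).1 (by simp [SimpleGraph.pathGraph_adj])
    have h02 : ¬ (G.induce (Subtype.val '' c.supp)).Adj (f 0) (f 2) := fun h => by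
      have := (hf 0 2).2 h
      simp [SimpleGraph.pathGraph_adj] at this
    refine h02 (S2_adj_trans hdart hC (hS _ (f 0).2) (hS _ (f 1).2) (hS _ (f 2).2) h01 h12 ?_)
    exact fun h => absurd (f.injective (Subtype.ext h)) (by decide)
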